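/- arXiv:0903.0888 — 2 statements merged into one kernel-verified Lean document; each statement's English description precedes it below -/
import Mathlib

section
/- For every positive integer i and all reals x, y with y > 1 and x > 0, the inequality |ψ^(i)(xy)| < |ψ^(i)(x)| + |ψ^(i)(y)| holds. -/
noncomputable def digamma : ℝ → ℝ := deriv (fun x => Real.log (Real.Gamma x))

noncomputable def polygamma (i : ℕ) : ℝ → ℝ := iteratedDeriv i digamma

open Filter Topology Set

theorem differentiableAt_log_Gamma {x : ℝ} (hx : 0 < x) :
    DifferentiableAt ℝ (fun x => Real.log (Real.Gamma x)) x :=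
  (Real.differentiableAt_Gamma fun m => by
    have : (0 : ℝ) ≤ m := m.cast_nonneg
    linarith).log (Real.Gamma_pos_of_pos hx).ne'

theorem digamma_add_one {x : ℝ} (hx : 0 < x) : digamma (x + 1) = digamma x + x⁻¹ := by
  have heq : (fun z => Real.log (Real.Gamma (z + 1))) =ᶠ[𝓝 x]
      fun z => Real.log (Real.Gamma z) + Real.log z := by
    filter_upwards [Ioi_mem_nhds hx] with z hz
    have hz' : 0 < z := hz
    rw [Real.Gamma_add_one hz'.ne', Real.log_mul hz'.ne' (Real.Gamma_pos_of_pos hz').ne', add_comm]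
  have h₁ : HasDerivAt (fun z => Real.log (Real.Gamma (z + 1))) (digamma (x + 1)) x :=
    (differentiableAt_log_Gamma (by linarith)).hasDerivAt.comp_add_const x 1
  have h₂ := ((differentiableAt_log_Gamma hx).hasDerivAt.add (Real.hasDerivAt_log hx.ne'))
    |>.congr_of_eventuallyEq heq
  exact h₁.unique h₂

theorem monotoneOn_digamma : MonotoneOn digamma (Ioi 0) :=
  Real.convexOn_log_Gamma.monotoneOn_deriv fun _ hz => differentiableAt_log_Gamma hz

theorem digamma_add_natCast {x : ℝ} (hx : 0 < x) (n : ℕ) :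
    digamma (x + n) = digamma x + ∑ j ∈ Finset.range n, (x + j)⁻¹ := by
  induction n with
  | zero => simp
  | succ n ih =>
    rw [Finset.sum_range_succ, Nat.cast_succ, ← add_assoc, digamma_add_one (by positivity), ih,
      add_assoc]

theorem tendsto_digamma_add_natCast_sub {x : ℝ} (hx : 0 < x) (M : ℕ) :
    Tendsto (fun n : ℕ => digamma (x + n + M) - digamma (x + n)) atTop (𝓝 0) := by
  have h : ∀ n : ℕ, digamma (x + n + M) - digamma (x + n) =
      ∑ j ∈ Finset.range M, (x + n + j)⁻¹ := fun n => by
    rw [digamma_add_natCast (by positivity)]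
    ring
  simp_rw [h]
  rw [← Finset.sum_const_zero (s := Finset.range M) (ι := ℕ)]
  exact tendsto_finsetSum _ fun j _ => tendsto_inv_atTop_zero.comp <|
    tendsto_atTop_add_const_right _ _ <|
      tendsto_atTop_add_const_left _ _ tendsto_natCast_atTop_atTop

theorem tendsto_digamma_add_natCast_sub_of_le {x y : ℝ} (hx : 0 < x) (hxy : x ≤ y) :
    Tendsto (fun n : ℕ => digamma (y + n) - digamma (x + n)) atTop (𝓝 0) := by
  obtain ⟨M, hM⟩ := exists_nat_ge (y - x)
  have hy : 0 < y := hx.trans_le hxy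
  refine squeeze_zero (fun n => ?_) (fun n => ?_) (tendsto_digamma_add_natCast_sub hx M)
  · exact sub_nonneg.2 (monotoneOn_digamma (mem_Ioi.2 (by positivity)) (mem_Ioi.2 (by positivity))
      (by gcongr))
  · exact sub_le_sub_right (monotoneOn_digamma (mem_Ioi.2 (by positivity))
      (mem_Ioi.2 (by positivity)) (by linarith)) _

theorem tendsto_sum_digamma {x : ℝ} (hx : 0 < x) :
    Tendsto (fun n : ℕ => ∑ j ∈ Finset.range n, ((1 + (j : ℝ))⁻¹ - (x + j)⁻¹)) atTop
      (𝓝 (digamma x - digamma 1)) := by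
  have h : ∀ n : ℕ, ∑ j ∈ Finset.range n, ((1 + (j : ℝ))⁻¹ - (x + j)⁻¹) =
      (digamma x - digamma 1) - (digamma (x + n) - digamma (1 + n)) := fun n => by
    rw [Finset.sum_sub_distrib, digamma_add_natCast hx, digamma_add_natCast one_pos]
    ring
  have h₀ : Tendsto (fun n : ℕ => digamma (x + n) - digamma (1 + n)) atTop (𝓝 0) := by
    rcases le_total x 1 with h₁ | h₁
    · simpa using (tendsto_digamma_add_natCast_sub_of_le hx h₁).neg
    · exact tendsto_digamma_add_natCast_sub_of_le one_pos h₁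
  simp_rw [h]
  simpa using h₀.const_sub (digamma x - digamma 1)

theorem summable_inv_add_natCast_pow {x : ℝ} (hx : 0 < x) (k : ℕ) :
    Summable fun n : ℕ => ((x + n) ^ (k + 2))⁻¹ := by
  refine ((Real.summable_one_div_nat_add_rpow x (k + 2 : ℕ)).2
    (by push_cast; linarith [(k.cast_nonneg : (0 : ℝ) ≤ k)])).congr fun n => ?_
  rw [Real.rpow_natCast, abs_of_pos (by positivity), one_div, add_comm]

theorem inv_add_natCast_pow_le {δ z : ℝ} (hδ : 0 < δ) (hz : δ < z) (k n : ℕ) :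
    ((z + n) ^ k)⁻¹ ≤ ((δ + n) ^ k)⁻¹ := by
  gcongr

theorem hasDerivAt_digamma {x : ℝ} (hx : 0 < x) :
    HasDerivAt digamma (∑' n : ℕ, ((x + n) ^ 2)⁻¹) x := by
  obtain ⟨δ, hδ, hδx⟩ := exists_between (lt_min hx one_pos)
  obtain ⟨hδx, hδ1⟩ := lt_min_iff.1 hδx
  have hg : ∀ (n : ℕ) (z : ℝ), z ∈ Ioi δ →
      HasDerivAt (fun z : ℝ => (1 + (n : ℝ))⁻¹ - (z + n)⁻¹) (((z + n) ^ 2)⁻¹) z := by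
    intro n z hz
    have hz₀ : 0 < z := hδ.trans hz
    have := (((hasDerivAt_id z).add_const (n : ℝ)).inv (by simp only [id]; positivity)).const_sub
      (1 + (n : ℝ))⁻¹
    convert! this using 1
    simp [neg_div]
  have hg' : ∀ (n : ℕ) (z : ℝ), z ∈ Ioi δ → ‖((z + n) ^ 2)⁻¹‖ ≤ ((δ + n) ^ 2)⁻¹ := by
    intro n z hz
    rw [Real.norm_of_nonneg (by positivity)]
    exact inv_add_natCast_pow_le hδ hz _ _
  have hs₁ : Summable fun n : ℕ => (1 + (n : ℝ))⁻¹ - (1 + (n : ℝ))⁻¹ := by simp [summable_zero]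
  have hu := summable_inv_add_natCast_pow hδ 0
  have hd := hasDerivAt_tsum_of_isPreconnected hu isOpen_Ioi isPreconnected_Ioi hg hg' hδ1 hs₁
    (mem_Ioi.2 hδx)
  refine (hd.add_const (digamma 1)).congr_of_eventuallyEq ?_
  filter_upwards [Ioi_mem_nhds hδx] with z hz
  have hs := summable_of_summable_hasDerivAt_of_isPreconnected hu isOpen_Ioi isPreconnected_Ioi
    hg hg' hδ1 hs₁ hz
  have := tendsto_nhds_unique hs.hasSum.tendsto_sum_nat (tendsto_sum_digamma (hδ.trans hz))
  rw [this]
  ring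

theorem hasDerivAt_tsum_inv_add_natCast_pow {x : ℝ} (hx : 0 < x) (k : ℕ) :
    HasDerivAt (fun z : ℝ => ∑' n : ℕ, ((z + n) ^ (k + 2))⁻¹)
      (-(k + 2) * ∑' n : ℕ, ((x + n) ^ (k + 3))⁻¹) x := by
  obtain ⟨δ, hδ, hδx⟩ := exists_between hx
  rw [← tsum_mul_left]
  refine hasDerivAt_tsum_of_isPreconnected
    (g := fun (n : ℕ) (z : ℝ) => ((z + n) ^ (k + 2))⁻¹)
    (g' := fun (n : ℕ) (z : ℝ) => -(k + 2) * ((z + n) ^ (k + 3))⁻¹)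
    ((summable_inv_add_natCast_pow hδ (k + 1)).mul_left ((k : ℝ) + 2))
    isOpen_Ioi isPreconnected_Ioi (fun n z hz => ?_) (fun n z hz => ?_) (mem_Ioi.2 hδx)
    (summable_inv_add_natCast_pow hx k) (mem_Ioi.2 hδx)
  · have hz₀ : 0 < z := hδ.trans hz
    have := (((hasDerivAt_id z).add_const (n : ℝ)).pow (k + 2)).inv
      (by simp only [id, Pi.pow_apply]; positivity)
    convert! this using 1
    have : z + n ≠ 0 := by positivity
    simp only [id, Pi.pow_apply]
    push_cast
    field_simp
    simp
    ring
  · have hz₀ : 0 < z := hδ.trans hz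
    rw [norm_mul, norm_neg, Real.norm_of_nonneg (by positivity : (0 : ℝ) ≤ k + 2),
      Real.norm_of_nonneg (by positivity)]
    exact mul_le_mul_of_nonneg_left (inv_add_natCast_pow_le hδ hz _ _) (by positivity)

theorem polygamma_add_one_eq_tsum (k : ℕ) {x : ℝ} (hx : 0 < x) :
    polygamma (k + 1) x =
      (-1) ^ k * (k + 1).factorial * ∑' n : ℕ, ((x + n) ^ (k + 2))⁻¹ := by
  induction k generalizing x with
  | zero => simpa [polygamma] using (hasDerivAt_digamma hx).deriv
  | succ k ih =>
    have heq : polygamma (k + 1) =ᶠ[𝓝 x] fun z =>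
        (-1) ^ k * (k + 1).factorial * ∑' n : ℕ, ((z + n) ^ (k + 2))⁻¹ := by
      filter_upwards [Ioi_mem_nhds hx] with z hz using ih hz
    rw [polygamma, iteratedDeriv_succ]
    refine heq.deriv_eq.trans ?_
    rw [((hasDerivAt_tsum_inv_add_natCast_pow hx k).const_mul _).deriv, Nat.factorial_succ (k + 1)]
    push_cast
    ring

theorem abs_polygamma_add_one (k : ℕ) {x : ℝ} (hx : 0 < x) :
    |polygamma (k + 1) x| = (k + 1).factorial * ∑' n : ℕ, ((x + n) ^ (k + 2))⁻¹ := by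
  rw [polygamma_add_one_eq_tsum k hx, abs_mul, abs_mul, abs_neg_one_pow, one_mul, Nat.abs_cast,
    abs_of_nonneg (tsum_nonneg fun n => by positivity)]

theorem strictAntiOn_abs_polygamma {i : ℕ} (hi : 0 < i) :
    StrictAntiOn (fun x => |polygamma i x|) (Ioi 0) := by
  obtain ⟨k, rfl⟩ := Nat.exists_eq_add_of_lt hi
  intro x (hx : 0 < x) y (hy : 0 < y) hxy
  simp only [zero_add, abs_polygamma_add_one k hx, abs_polygamma_add_one k hy]
  refine mul_lt_mul_of_pos_left ?_ (by positivity)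
  refine Summable.tsum_lt_tsum (i := 0) (inv_add_natCast_pow_le hx hxy (k + 2)) ?_
    (summable_inv_add_natCast_pow hy k) (summable_inv_add_natCast_pow hx k)
  gcongr

theorem stmt9 (i : ℕ) (hi : 0 < i) (x y : ℝ) (hx : 0 < x) (hy : 1 < y) :
    |polygamma i (x * y)| < |polygamma i x| + |polygamma i y| :=
  (strictAntiOn_abs_polygamma hi hx (mul_pos hx (one_pos.trans hy))
    (lt_mul_of_one_lt_right hx hy)).trans_le (le_add_of_nonneg_right (abs_nonneg _))
end

section
/- For every positive integer i there exists a unique θ_i ∈ (0, 1) with 2|ψ^(i)(θ_i)| = |ψ^(i)(θ_i²)|, and the function F(x) = |ψ^(i)(e^x)| is super-additive on (−∞, ln θ_i): for all x, y < ln θ_i, F(x + y) ≥ F(x) + F(y). -/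
open Filter Topology Set

/-- The Hurwitz-type series `∑ (x + k)⁻ⁿ`. -/
noncomputable def hurwitzSum (n : ℕ) (x : ℝ) : ℝ := ∑' k : ℕ, ((x + k) ^ n)⁻¹

lemma summable_inv_succ_sq : Summable fun k : ℕ => (((k : ℝ) + 1) ^ 2)⁻¹ := by
  have h := (summable_nat_add_iff 1).2 (Real.summable_nat_pow_inv.2 one_lt_two)
  simpa using h

lemma mul_succ_le_add {ε y : ℝ} (hε1 : ε < 1) (hy : ε < y) (k : ℕ) :
    ε * ((k : ℝ) + 1) ≤ y + k := by
  have hk : (0 : ℝ) ≤ k := k.cast_nonneg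
  nlinarith

lemma inv_add_pow_le {ε y : ℝ} (hε : 0 < ε) (hε1 : ε < 1) (hy : ε < y) (m k : ℕ) :
    ((y + k) ^ (m + 2))⁻¹ ≤ (ε ^ (m + 2))⁻¹ * (((k : ℝ) + 1) ^ 2)⁻¹ := by
  have hk : (0 : ℝ) ≤ k := k.cast_nonneg
  have h1 : (ε * ((k : ℝ) + 1)) ^ (m + 2) ≤ (y + k) ^ (m + 2) :=
    pow_le_pow_left₀ (by positivity) (mul_succ_le_add hε1 hy k) _
  have h2 : ((k : ℝ) + 1) ^ 2 ≤ ((k : ℝ) + 1) ^ (m + 2) :=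
    pow_le_pow_right₀ (by linarith) (by omega)
  rw [← mul_inv]
  apply inv_anti₀ (by positivity)
  rw [mul_pow] at h1
  exact le_trans (mul_le_mul_of_nonneg_left h2 (by positivity)) h1

lemma exists_pos_lt_one_lt {x : ℝ} (hx : 0 < x) : ∃ ε, 0 < ε ∧ ε < 1 ∧ ε < x := by
  obtain ⟨ε, h0, h1⟩ := exists_between (lt_min one_pos hx)
  exact ⟨ε, h0, h1.trans_le (min_le_left _ _), h1.trans_le (min_le_right _ _)⟩

lemma summable_hurwitzSum (m : ℕ) {x : ℝ} (hx : 0 < x) :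
    Summable fun k : ℕ => ((x + k) ^ (m + 2))⁻¹ := by
  obtain ⟨ε, h0, h1, hεx⟩ := exists_pos_lt_one_lt hx
  exact Summable.of_nonneg_of_le (fun k => by positivity)
    (fun k => inv_add_pow_le h0 h1 hεx m k) (summable_inv_succ_sq.mul_left _)

lemma hurwitzSum_pos (m : ℕ) {x : ℝ} (hx : 0 < x) : 0 < hurwitzSum (m + 2) x :=
  (summable_hurwitzSum m hx).tsum_pos (fun k => by positivity) 0 (by positivity)

lemma hasDerivAt_inv_add_pow (n k : ℕ) {y : ℝ} (hy : 0 < y) :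
    HasDerivAt (fun z : ℝ => ((z + k) ^ n)⁻¹) (-n * ((y + k) ^ (n + 1))⁻¹) y := by
  have hk : 0 < y + k := by positivity
  have h := (((hasDerivAt_id y).add_const (k : ℝ)).pow n).inv (pow_ne_zero n hk.ne')
  convert! h using 1
  rcases n with _ | n
  · simp
  · simp
    field_simp
    ring

lemma hasDerivAt_hurwitzSum (m : ℕ) {x : ℝ} (hx : 0 < x) :
    HasDerivAt (hurwitzSum (m + 2)) (-((m + 2 : ℕ) : ℝ) * hurwitzSum (m + 3) x) x := by
  obtain ⟨ε, h0, h1, hεx⟩ := exists_pos_lt_one_lt hx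
  have h := hasDerivAt_tsum_of_isPreconnected (𝕜 := ℝ) (t := Ioi ε) (y₀ := x) (y := x)
    (g := fun (k : ℕ) (z : ℝ) => ((z + k) ^ (m + 2))⁻¹)
    (g' := fun (k : ℕ) (z : ℝ) => -((m + 2 : ℕ) : ℝ) * ((z + k) ^ (m + 3))⁻¹)
    ((summable_inv_succ_sq.mul_left (ε ^ (m + 3))⁻¹).mul_left ((m + 2 : ℕ) : ℝ))
    isOpen_Ioi isPreconnected_Ioi
    (fun k y hy => hasDerivAt_inv_add_pow (m + 2) k (h0.trans hy))
    (fun k y hy => by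
      have hy0 : 0 < y := h0.trans hy
      rw [norm_mul, norm_neg, Real.norm_of_nonneg (by positivity),
        Real.norm_of_nonneg (by positivity)]
      exact mul_le_mul_of_nonneg_left (inv_add_pow_le h0 h1 hy (m + 1) k) (by positivity))
    hεx (summable_hurwitzSum m hx) hεx
  rw [tsum_mul_left] at h
  exact h

/-- The terms of the series expansion of `log Γ`. -/
noncomputable def logGammaTerm (k : ℕ) (x : ℝ) : ℝ :=
  (x - 1) * ((k : ℝ) + 1)⁻¹ - Real.log (x + k) + Real.log (k + 1)

/-- The terms of the series expansion of the digamma function. -/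
noncomputable def digammaTerm (k : ℕ) (x : ℝ) : ℝ := ((k : ℝ) + 1)⁻¹ - (x + k)⁻¹

lemma hasDerivAt_logGammaTerm (k : ℕ) {y : ℝ} (hy : 0 < y) :
    HasDerivAt (logGammaTerm k) (digammaTerm k y) y := by
  have hk : y + k ≠ 0 := by positivity
  have h1 := ((hasDerivAt_id y).sub_const 1).mul_const (((k : ℝ) + 1)⁻¹)
  have h2 := ((hasDerivAt_id y).add_const (k : ℝ)).log hk
  convert! (h1.sub h2).add_const (Real.log (k + 1)) using 1
  simp [digammaTerm]

lemma norm_digammaTerm_le {ε R y : ℝ} (h0 : 0 < ε) (h1 : ε < 1) (hR : 1 < R) (hy : y ∈ Ioo ε R)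
    (k : ℕ) : ‖digammaTerm k y‖ ≤ (R * ε⁻¹) * (((k : ℝ) + 1) ^ 2)⁻¹ := by
  have hy0 : 0 < y := h0.trans hy.1
  have hle := mul_succ_le_add h1 hy.1 k
  have hyR := hy.2
  have heq : digammaTerm k y = (y - 1) * (((k : ℝ) + 1)⁻¹ * (y + k)⁻¹) := by
    unfold digammaTerm
    field_simp
    ring
  have habs : |y - 1| ≤ R := abs_le.2 ⟨by linarith, by linarith⟩
  have hinv : (y + k)⁻¹ ≤ (ε * ((k : ℝ) + 1))⁻¹ := inv_anti₀ (by positivity) hle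
  rw [heq, norm_mul, Real.norm_eq_abs, Real.norm_of_nonneg (by positivity)]
  calc |y - 1| * (((k : ℝ) + 1)⁻¹ * (y + k)⁻¹)
      ≤ R * (((k : ℝ) + 1)⁻¹ * (ε * ((k : ℝ) + 1))⁻¹) := by gcongr
    _ = _ := by field_simp

lemma summable_logGammaTerm_and_hasDerivAt {x : ℝ} (hx : 0 < x) :
    Summable (fun k => logGammaTerm k x) ∧ Summable (fun k => digammaTerm k x) ∧
      HasDerivAt (fun z => ∑' k, logGammaTerm k z) (∑' k, digammaTerm k x) x := by
  obtain ⟨ε, h0, h1, hεx⟩ := exists_pos_lt_one_lt hx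
  have hR : 1 < x + 1 := by linarith
  have hu := summable_inv_succ_sq.mul_left ((x + 1) * ε⁻¹)
  have hxt : x ∈ Ioo ε (x + 1) := ⟨hεx, by linarith⟩
  have h1t : (1 : ℝ) ∈ Ioo ε (x + 1) := ⟨h1, hR⟩
  have hg : ∀ (k : ℕ) y, y ∈ Ioo ε (x + 1) →
      HasDerivAt (logGammaTerm k) (digammaTerm k y) y :=
    fun k y hy => hasDerivAt_logGammaTerm k (h0.trans hy.1)
  have hg' := fun (k : ℕ) y (hy : y ∈ Ioo ε (x + 1)) => norm_digammaTerm_le h0 h1 hR hy k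
  have hs1 : Summable (fun k => logGammaTerm k 1) := by
    have : (fun k => logGammaTerm k 1) = fun _ => 0 := by
      funext k
      simp [logGammaTerm, add_comm]
    rw [this]
    exact summable_zero
  exact ⟨summable_of_summable_hasDerivAt_of_isPreconnected hu isOpen_Ioo isPreconnected_Ioo
      hg hg' h1t hs1 hxt,
    Summable.of_norm_bounded hu fun k => hg' k x hxt,
    hasDerivAt_tsum_of_isPreconnected hu isOpen_Ioo isPreconnected_Ioo hg hg' h1t hs1 hxt⟩

lemma sum_logGammaTerm (x : ℝ) (n : ℕ) :
    ∑ k ∈ Finset.range (n + 1), logGammaTerm k x =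
      Real.BohrMollerup.logGammaSeq x n
        + (x - 1) * ((harmonic (n + 1) : ℝ) - Real.log ((n + 1 : ℕ) : ℝ))
        + x * (Real.log ((n : ℝ) + 1) - Real.log n) := by
  have hfac : ∀ N : ℕ, ∑ k ∈ Finset.range N, Real.log ((k : ℝ) + 1) =
      Real.log (N.factorial : ℝ) := by
    intro N
    induction N with
    | zero => simp
    | succ N ih =>
      rw [Finset.sum_range_succ, ih, Nat.factorial_succ, Nat.cast_mul,
        Real.log_mul (by positivity) (by positivity)]
      push_cast
      ring
  have hh : ∑ k ∈ Finset.range (n + 1), (x - 1) * ((k : ℝ) + 1)⁻¹ =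
      (x - 1) * (harmonic (n + 1) : ℝ) := by
    rw [← Finset.mul_sum]
    simp [harmonic]
  have hn := hfac n
  unfold logGammaTerm Real.BohrMollerup.logGammaSeq
  rw [Finset.sum_add_distrib, Finset.sum_sub_distrib, hh, Finset.sum_range_succ
    (fun k : ℕ => Real.log ((k : ℝ) + 1)), hn]
  push_cast
  ring

lemma log_Gamma_eq_tsum {x : ℝ} (hx : 0 < x) :
    Real.log (Real.Gamma x) =
      ∑' k, logGammaTerm k x - (x - 1) * Real.eulerMascheroniConstant := by
  have h1 := (summable_logGammaTerm_and_hasDerivAt hx).1.hasSum.tendsto_sum_nat.comp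
    (tendsto_add_atTop_nat 1)
  have h2 := ((Real.BohrMollerup.tendsto_log_gamma hx).add
    ((Real.tendsto_harmonic_sub_log.comp (tendsto_add_atTop_nat 1)).const_mul (x - 1))).add
    (Real.tendsto_log_nat_add_one_sub_log.const_mul x)
  have h3 := tendsto_nhds_unique h1 (h2.congr fun n => (sum_logGammaTerm x n).symm)
  linarith

lemma digamma_eq_tsum {x : ℝ} (hx : 0 < x) :
    digamma x = ∑' k, digammaTerm k x - Real.eulerMascheroniConstant := by
  have h := (summable_logGammaTerm_and_hasDerivAt hx).2.2.sub
    (((hasDerivAt_id x).sub_const 1).mul_const Real.eulerMascheroniConstant)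
  rw [one_mul] at h
  refine (h.congr_of_eventuallyEq ?_).deriv
  filter_upwards [Ioi_mem_nhds hx] with y hy
  exact log_Gamma_eq_tsum hy

lemma hasDerivAt_digamma_s12 {x : ℝ} (hx : 0 < x) : HasDerivAt digamma (hurwitzSum 2 x) x := by
  obtain ⟨ε, h0, h1, hεx⟩ := exists_pos_lt_one_lt hx
  have h := hasDerivAt_tsum_of_isPreconnected (𝕜 := ℝ) (t := Ioi ε) (y₀ := x) (y := x)
    (g := digammaTerm)
    (g' := fun (k : ℕ) (z : ℝ) => ((z + k) ^ 2)⁻¹)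
    (summable_inv_succ_sq.mul_left (ε ^ 2)⁻¹)
    isOpen_Ioi isPreconnected_Ioi
    (fun k y hy => by
      have h := (hasDerivAt_inv_add_pow 1 k (h0.trans hy)).const_sub (((k : ℝ) + 1)⁻¹)
      simp only [pow_one] at h
      convert! h using 1
      simp)
    (fun k y hy => by
      have hy0 : 0 < y := h0.trans hy
      rw [Real.norm_of_nonneg (by positivity)]
      exact inv_add_pow_le h0 h1 hy 0 k)
    hεx (summable_logGammaTerm_and_hasDerivAt hx).2.1 hεx
  refine (h.sub_const Real.eulerMascheroniConstant).congr_of_eventuallyEq ?_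
  filter_upwards [Ioi_mem_nhds hx] with y hy
  exact digamma_eq_tsum hy

lemma polygamma_succ_eq (m : ℕ) {x : ℝ} (hx : 0 < x) :
    polygamma (m + 1) x = (-1) ^ m * ((m + 1).factorial : ℝ) * hurwitzSum (m + 2) x := by
  induction m generalizing x with
  | zero => simp [polygamma, iteratedDeriv_one, (hasDerivAt_digamma_s12 hx).deriv]
  | succ m ih =>
    have h : polygamma (m + 1) =ᶠ[𝓝 x]
        fun y => (-1) ^ m * ((m + 1).factorial : ℝ) * hurwitzSum (m + 2) y := by
      filter_upwards [Ioi_mem_nhds hx] with y hy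
      exact ih hy
    have hd : polygamma (m + 1 + 1) x = deriv (polygamma (m + 1)) x := by
      simp only [polygamma]
      rw [iteratedDeriv_succ]
    rw [hd, h.deriv_eq, ((hasDerivAt_hurwitzSum m hx).const_mul _).deriv,
      Nat.factorial_succ (m + 1)]
    push_cast
    ring

lemma abs_polygamma_succ (m : ℕ) {x : ℝ} (hx : 0 < x) :
    |polygamma (m + 1) x| = ((m + 1).factorial : ℝ) * hurwitzSum (m + 2) x := by
  have := hurwitzSum_pos m hx
  rw [polygamma_succ_eq m hx, abs_mul, abs_mul, abs_pow, abs_neg, abs_one, one_pow, one_mul,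
    abs_of_pos this, abs_of_nonneg (by positivity)]

/-- A tangent-line bound for `a ↦ a⁻ⁿ`. -/
lemma inv_pow_add_le_inv_pow_sub_one (n : ℕ) {b : ℝ} (hb : 0 < b) :
    ((b + 1) ^ n)⁻¹ + n * ((b + 1) ^ (n + 1))⁻¹ ≤ (b ^ n)⁻¹ := by
  have hbern : 1 + n * b⁻¹ ≤ (1 + b⁻¹) ^ n :=
    one_add_mul_le_pow (by have := inv_pos.2 hb; linarith) n
  have hle : (n : ℝ) * (b + 1)⁻¹ ≤ n * b⁻¹ := by gcongr; linarith
  have heq : 1 + b⁻¹ = (b + 1) * b⁻¹ := by field_simp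
  rw [heq, mul_pow] at hbern
  calc ((b + 1) ^ n)⁻¹ + n * ((b + 1) ^ (n + 1))⁻¹
      = ((b + 1) ^ n)⁻¹ * (1 + n * (b + 1)⁻¹) := by rw [pow_succ]; field_simp
    _ ≤ ((b + 1) ^ n)⁻¹ * ((b + 1) ^ n * b⁻¹ ^ n) := by gcongr; linarith
    _ = (b ^ n)⁻¹ := by rw [inv_mul_cancel_left₀ (by positivity), inv_pow]

lemma succ_mul_hurwitzSum_le (m : ℕ) {x : ℝ} (hx : 0 < x) :
    ((m : ℝ) + 1) * hurwitzSum (m + 2) x ≤ ((m : ℝ) + 2) * (x * hurwitzSum (m + 3) x) := by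
  have hs := (((summable_hurwitzSum (m + 1) hx).hasSum.mul_left x).mul_left ((m : ℝ) + 2)).sub
    ((summable_hurwitzSum m hx).hasSum.mul_left ((m : ℝ) + 1))
  have hpart : ∀ N : ℕ, ((N : ℝ) + 1) * ((x + N) ^ (m + 2))⁻¹ ≤
      ∑ k ∈ Finset.range (N + 1), (((m : ℝ) + 2) * (x * ((x + k) ^ (m + 1 + 2))⁻¹) -
        ((m : ℝ) + 1) * ((x + k) ^ (m + 2))⁻¹) := by
    intro N
    induction N with
    | zero =>
      simp
      apply le_of_eq
      field_simp
      ring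
    | succ N ih =>
      rw [Finset.sum_range_succ]
      have hb : 0 < x + N := by positivity
      have ht := inv_pow_add_le_inv_pow_sub_one (m + 2) hb
      have ht' := mul_le_mul_of_nonneg_left ht (by positivity : (0 : ℝ) ≤ N + 1)
      have e1 : x + ((N + 1 : ℕ) : ℝ) = x + N + 1 := by push_cast; ring
      have e2 : ((x + N + 1) ^ (m + 2))⁻¹ = (x + N + 1) * ((x + N + 1) ^ (m + 2 + 1))⁻¹ := by
        rw [pow_succ _ (m + 2)]
        field_simp
      have e3 : m + 1 + 2 = m + 2 + 1 := by ring
      refine le_trans ?_ (add_le_add_left (le_trans ht' ih) _)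
      rw [e1, e3, e2]
      push_cast
      apply le_of_eq
      ring
  have h0 := ge_of_tendsto' (hs.tendsto_sum_nat.comp (tendsto_add_atTop_nat 1))
    fun N => le_trans (by positivity) (hpart N)
  have : 0 ≤ ((m : ℝ) + 2) * (x * hurwitzSum (m + 1 + 2) x) -
    ((m : ℝ) + 1) * hurwitzSum (m + 2) x := h0
  have e : m + 1 + 2 = m + 3 := by ring
  rw [e] at this
  linarith

lemma antitoneOn_pow_mul_hurwitzSum (m : ℕ) :
    AntitoneOn (fun x => x ^ (m + 1) * hurwitzSum (m + 2) x) (Ioi 0) := by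
  have hd : ∀ x ∈ Ioi (0 : ℝ), HasDerivAt (fun x => x ^ (m + 1) * hurwitzSum (m + 2) x)
      (x ^ m * (((m : ℝ) + 1) * hurwitzSum (m + 2) x -
        ((m : ℝ) + 2) * (x * hurwitzSum (m + 3) x))) x := by
    intro x hx
    convert! (hasDerivAt_pow (m + 1) x).mul (hasDerivAt_hurwitzSum m hx) using 1
    rw [Nat.add_sub_cancel]
    push_cast
    ring
  refine antitoneOn_of_deriv_nonpos (convex_Ioi 0)
    (fun x hx => (hd x hx).continuousAt.continuousWithinAt) ?_ ?_
  · rw [interior_Ioi]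
    exact fun x hx => (hd x hx).differentiableAt.differentiableWithinAt
  · rw [interior_Ioi]
    intro x hx
    rw [(hd x hx).deriv]
    have hx0 : 0 < x := hx
    exact mul_nonpos_of_nonneg_of_nonpos (by positivity)
      (sub_nonpos.2 (succ_mul_hurwitzSum_le m hx))

lemma strictMonoOn_pow_mul_hurwitzSum (m : ℕ) :
    StrictMonoOn (fun x => x ^ (m + 2) * hurwitzSum (m + 2) x) (Ioi 0) := by
  intro a ha b hb hab
  have ha0 : 0 < a := ha
  have hb0 : 0 < b := hb
  have hle : ∀ k : ℕ, a ^ (m + 2) * ((a + k) ^ (m + 2))⁻¹ ≤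
      b ^ (m + 2) * ((b + k) ^ (m + 2))⁻¹ := by
    intro k
    rw [← inv_pow, ← inv_pow, ← mul_pow, ← mul_pow]
    refine pow_le_pow_left₀ (by positivity) ?_ _
    rw [← div_eq_mul_inv, ← div_eq_mul_inv, div_le_div_iff₀ (by positivity) (by positivity)]
    have : (0 : ℝ) ≤ k := k.cast_nonneg
    nlinarith
  have hlt : a ^ (m + 2) * ((a + (1 : ℕ)) ^ (m + 2))⁻¹ <
      b ^ (m + 2) * ((b + (1 : ℕ)) ^ (m + 2))⁻¹ := by
    rw [← inv_pow, ← inv_pow, ← mul_pow, ← mul_pow]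
    refine pow_lt_pow_left₀ ?_ (by positivity) (by omega)
    rw [← div_eq_mul_inv, ← div_eq_mul_inv, div_lt_div_iff₀ (by positivity) (by positivity)]
    push_cast
    nlinarith
  have h := Summable.tsum_lt_tsum hle hlt ((summable_hurwitzSum m ha0).mul_left _)
    ((summable_hurwitzSum m hb0).mul_left _)
  rw [tsum_mul_left, tsum_mul_left] at h
  exact h

lemma strictAntiOn_hurwitzSum_sq_div (m : ℕ) :
    StrictAntiOn (fun x => hurwitzSum (m + 2) (x ^ 2) / hurwitzSum (m + 2) x) (Ioi 0) := by
  intro a ha b hb hab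
  have ha0 : 0 < a := ha
  have hb0 : 0 < b := hb
  have hsq : a ^ 2 ≤ b ^ 2 := pow_le_pow_left₀ ha0.le hab.le 2
  have h1 : (b ^ 2) ^ (m + 1) * hurwitzSum (m + 2) (b ^ 2) ≤
      (a ^ 2) ^ (m + 1) * hurwitzSum (m + 2) (a ^ 2) :=
    antitoneOn_pow_mul_hurwitzSum m (pow_pos ha0 2) (pow_pos hb0 2) hsq
  have h2 : a ^ (m + 2) * hurwitzSum (m + 2) a < b ^ (m + 2) * hurwitzSum (m + 2) b :=
    strictMonoOn_pow_mul_hurwitzSum m ha hb hab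
  have pa := hurwitzSum_pos m ha0
  have pb := hurwitzSum_pos m hb0
  have pa2 := hurwitzSum_pos m (pow_pos ha0 2)
  have pb2 := hurwitzSum_pos m (pow_pos hb0 2)
  have h3 : a ^ m ≤ b ^ m := pow_le_pow_left₀ ha0.le hab.le m
  simp only
  rw [div_lt_div_iff₀ pb pa]
  have h5 : a ^ (m + 2) * hurwitzSum (m + 2) a * ((b ^ 2) ^ (m + 1) * hurwitzSum (m + 2) (b ^ 2))
      < b ^ (m + 2) * hurwitzSum (m + 2) b * ((a ^ 2) ^ (m + 1) * hurwitzSum (m + 2) (a ^ 2)) :=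
    mul_lt_mul h2 h1 (by positivity) (by positivity)
  have h6 : a ^ (m + 2) * b ^ (m + 2) * b ^ m *
        (hurwitzSum (m + 2) (b ^ 2) * hurwitzSum (m + 2) a) <
      a ^ (m + 2) * b ^ (m + 2) * b ^ m *
        (hurwitzSum (m + 2) (a ^ 2) * hurwitzSum (m + 2) b) := by
    calc _ = a ^ (m + 2) * hurwitzSum (m + 2) a *
          ((b ^ 2) ^ (m + 1) * hurwitzSum (m + 2) (b ^ 2)) := by ring
      _ < _ := h5
      _ = a ^ (m + 2) * b ^ (m + 2) * a ^ m *
        (hurwitzSum (m + 2) (a ^ 2) * hurwitzSum (m + 2) b) := by ring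
      _ ≤ _ := by gcongr
  exact lt_of_mul_lt_mul_left h6 (by positivity)

lemma continuousOn_hurwitzSum (m : ℕ) : ContinuousOn (hurwitzSum (m + 2)) (Ioi 0) :=
  fun _ hx => (hasDerivAt_hurwitzSum m hx).continuousAt.continuousWithinAt

lemma inv_pow_le_hurwitzSum (m : ℕ) {x : ℝ} (hx : 0 < x) :
    (x ^ (m + 2))⁻¹ ≤ hurwitzSum (m + 2) x := by
  have h := (summable_hurwitzSum m hx).le_tsum 0 (fun k _ => by positivity)
  simpa [hurwitzSum] using h

lemma hurwitzSum_le (m : ℕ) {x : ℝ} (hx : 0 < x) :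
    hurwitzSum (m + 2) x ≤ (x ^ (m + 2))⁻¹ + hurwitzSum (m + 2) 1 := by
  have hs := summable_hurwitzSum m hx
  unfold hurwitzSum
  rw [hs.tsum_eq_zero_add]
  simp only [Nat.cast_zero, add_zero]
  refine add_le_add_right (Summable.tsum_le_tsum (fun k => ?_)
    ((summable_nat_add_iff 1).2 hs) (summable_hurwitzSum m one_pos)) _
  apply inv_anti₀ (by positivity)
  apply pow_le_pow_left₀ (by positivity)
  push_cast
  linarith

lemma exists_two_mul_hurwitzSum_le (m : ℕ) :
    ∃ a ∈ Ioo (0 : ℝ) 1, 2 * hurwitzSum (m + 2) a ≤ hurwitzSum (m + 2) (a ^ 2) := by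
  set C := hurwitzSum (m + 2) 1 with hC
  have hC0 : 0 < C := hurwitzSum_pos m one_pos
  have hT : (1 : ℝ) < 3 + 2 * C := by linarith
  have ha0 : 0 < (3 + 2 * C)⁻¹ := by positivity
  refine ⟨(3 + 2 * C)⁻¹, ⟨ha0, inv_lt_one_of_one_lt₀ hT⟩, ?_⟩
  have h1 := hurwitzSum_le m ha0
  have h2 := inv_pow_le_hurwitzSum m (pow_pos ha0 2)
  rw [← hC] at h1
  rw [← pow_mul, mul_comm 2 (m + 2), pow_mul] at h2
  rw [← inv_pow, inv_inv] at h1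
  have e : ((((3 + 2 * C)⁻¹ ^ (m + 2)) ^ 2)⁻¹) = ((3 + 2 * C) ^ (m + 2)) ^ 2 := by
    rw [inv_pow, inv_pow, inv_inv]
  rw [e] at h2
  have h3 : 3 + 2 * C ≤ (3 + 2 * C) ^ (m + 2) := le_self_pow₀ hT.le (by omega)
  set t := (3 + 2 * C) ^ (m + 2)
  nlinarith

lemma exists_two_mul_hurwitzSum_eq (m : ℕ) :
    ∃ θ ∈ Ioo (0 : ℝ) 1, 2 * hurwitzSum (m + 2) θ = hurwitzSum (m + 2) (θ ^ 2) := by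
  obtain ⟨a, ⟨ha0, ha1⟩, ha⟩ := exists_two_mul_hurwitzSum_le m
  have hsub : ∀ x ∈ Icc a 1, 0 < x := fun x hx => ha0.trans_le hx.1
  have hcont : ContinuousOn
      (fun x => 2 * hurwitzSum (m + 2) x - hurwitzSum (m + 2) (x ^ 2)) (Icc a 1) := by
    refine ContinuousOn.sub (continuousOn_const.mul ((continuousOn_hurwitzSum m).mono hsub)) ?_
    exact (continuousOn_hurwitzSum m).comp (by fun_prop) fun x hx => pow_pos (hsub x hx) 2
  have h1 := hurwitzSum_pos m one_pos
  have hmem : (0 : ℝ) ∈ Icc (2 * hurwitzSum (m + 2) a - hurwitzSum (m + 2) (a ^ 2))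
      (2 * hurwitzSum (m + 2) 1 - hurwitzSum (m + 2) (1 ^ 2)) := by
    rw [one_pow]
    constructor <;> linarith
  obtain ⟨θ, hθ, h⟩ := intermediate_value_Icc ha1.le hcont hmem
  simp only at h
  refine ⟨θ, ⟨hsub θ hθ, lt_of_le_of_ne hθ.2 ?_⟩, by linarith⟩
  rintro rfl
  rw [one_pow] at h
  linarith

/-- For fixed `b ∈ (0, 1]`, the gap `hurwitzSum (a * b) - hurwitzSum a` decreases in `a`. -/
lemma antitoneOn_hurwitzSum_mul_sub (m : ℕ) {b : ℝ} (hb0 : 0 < b) (hb1 : b ≤ 1) :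
    AntitoneOn (fun a => hurwitzSum (m + 2) (a * b) - hurwitzSum (m + 2) a) (Ioi 0) := by
  have hd : ∀ a ∈ Ioi (0 : ℝ),
      HasDerivAt (fun a => hurwitzSum (m + 2) (a * b) - hurwitzSum (m + 2) a)
        (((m + 2 : ℕ) : ℝ) * (hurwitzSum (m + 3) a - b * hurwitzSum (m + 3) (a * b))) a := by
    intro a ha
    have hab : 0 < a * b := mul_pos ha hb0
    have h1 := (hasDerivAt_hurwitzSum m hab).comp a ((hasDerivAt_id a).mul_const b)
    convert! h1.sub (hasDerivAt_hurwitzSum m ha) using 1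
    ring
  refine antitoneOn_of_deriv_nonpos (convex_Ioi 0)
    (fun x hx => (hd x hx).continuousAt.continuousWithinAt) ?_ ?_
  · rw [interior_Ioi]
    exact fun x hx => (hd x hx).differentiableAt.differentiableWithinAt
  · rw [interior_Ioi]
    intro a ha
    rw [(hd a ha).deriv]
    have ha0 : 0 < a := ha
    have hab : 0 < a * b := mul_pos ha0 hb0
    have h1 : a ^ (m + 2) * hurwitzSum (m + 3) a ≤
        (a * b) ^ (m + 2) * hurwitzSum (m + 3) (a * b) :=
      antitoneOn_pow_mul_hurwitzSum (m + 1) hab ha (mul_le_of_le_one_right ha0.le hb1)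
    rw [mul_pow, mul_assoc] at h1
    have h2 := le_of_mul_le_mul_left h1 (by positivity)
    have hpos : 0 < hurwitzSum (m + 3) (a * b) := hurwitzSum_pos (m + 1) hab
    have h3 : b ^ (m + 2) ≤ b := pow_le_of_le_one hb0.le hb1 (by omega)
    have h4 := mul_le_mul_of_nonneg_right h3 hpos.le
    exact mul_nonpos_of_nonneg_of_nonpos (by positivity) (by linarith)

lemma hurwitzSum_add_le_mul (m : ℕ) {a b : ℝ} (ha : 0 < a) (hab : a ≤ b) (hb1 : b ≤ 1)
    (hb : 2 * hurwitzSum (m + 2) b ≤ hurwitzSum (m + 2) (b ^ 2)) :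
    hurwitzSum (m + 2) a + hurwitzSum (m + 2) b ≤ hurwitzSum (m + 2) (a * b) := by
  have hb0 : 0 < b := ha.trans_le hab
  have h : hurwitzSum (m + 2) (b * b) - hurwitzSum (m + 2) b ≤
      hurwitzSum (m + 2) (a * b) - hurwitzSum (m + 2) a :=
    antitoneOn_hurwitzSum_mul_sub m hb0 hb1 ha hb0 hab
  rw [pow_two] at hb
  linarith

theorem stmt12 (i : ℕ) (hi : 0 < i) :
    ∃ θ : ℝ, θ ∈ Set.Ioo (0 : ℝ) 1 ∧
      2 * |polygamma i θ| = |polygamma i (θ ^ 2)| ∧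
      (∀ θ' ∈ Set.Ioo (0 : ℝ) 1, 2 * |polygamma i θ'| = |polygamma i (θ' ^ 2)| → θ' = θ) ∧
      ∀ x y : ℝ, x < Real.log θ → y < Real.log θ →
        |polygamma i (Real.exp x)| + |polygamma i (Real.exp y)| ≤ |polygamma i (Real.exp (x + y))| := by
  obtain ⟨m, rfl⟩ : ∃ m, i = m + 1 := ⟨i - 1, by omega⟩
  obtain ⟨θ, ⟨h0, h1⟩, hθ⟩ := exists_two_mul_hurwitzSum_eq m
  have hfac : (0 : ℝ) < ((m + 1).factorial : ℝ) := by positivity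
  have hratio : hurwitzSum (m + 2) (θ ^ 2) / hurwitzSum (m + 2) θ = 2 := by
    rw [← hθ, mul_div_cancel_right₀ _ (hurwitzSum_pos m h0).ne']
  refine ⟨θ, ⟨h0, h1⟩, ?_, ?_, ?_⟩
  · rw [abs_polygamma_succ m h0, abs_polygamma_succ m (pow_pos h0 2), ← hθ]
    ring
  · rintro η ⟨hη0, -⟩ hη
    rw [abs_polygamma_succ m hη0, abs_polygamma_succ m (pow_pos hη0 2), mul_left_comm] at hη
    have hη' := mul_left_cancel₀ hfac.ne' hη
    refine (strictAntiOn_hurwitzSum_sq_div m).injOn hη0 h0 ?_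
    rw [hratio, ← hη', mul_div_cancel_right₀ _ (hurwitzSum_pos m hη0).ne']
  · have hdouble : ∀ b, 0 < b → b < θ →
        2 * hurwitzSum (m + 2) b ≤ hurwitzSum (m + 2) (b ^ 2) := by
      intro b hb hbθ
      have h := strictAntiOn_hurwitzSum_sq_div m hb h0 hbθ
      simp only at h
      rw [hratio, lt_div_iff₀ (hurwitzSum_pos m hb)] at h
      exact h.le
    intro x y hx hy
    have hxθ := (Real.lt_log_iff_exp_lt h0).1 hx
    have hyθ := (Real.lt_log_iff_exp_lt h0).1 hy
    rw [Real.exp_add, abs_polygamma_succ m (Real.exp_pos x), abs_polygamma_succ m (Real.exp_pos y),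
      abs_polygamma_succ m (mul_pos (Real.exp_pos x) (Real.exp_pos y)), ← mul_add]
    refine mul_le_mul_of_nonneg_left ?_ hfac.le
    rcases le_total (Real.exp x) (Real.exp y) with hxy | hxy
    · exact hurwitzSum_add_le_mul m (Real.exp_pos x) hxy (hyθ.trans h1).le
        (hdouble _ (Real.exp_pos y) hyθ)
    · rw [add_comm, mul_comm]
      exact hurwitzSum_add_le_mul m (Real.exp_pos y) hxy (hxθ.trans h1).le
        (hdouble _ (Real.exp_pos x) hxθ)
end
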